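/- Let 1 ≤ p < 2. Then there exist constants c₁, c₂ > 0, depending only on p, such that for every N ∈ ℕ and every k ∈ ℕ with 4k ≤ N one has c₁ · k^{−1/2} ≤ d_k(id : ℓ_p^N → ℓ_∞^N) ≤ c₂ · k^{−1/2} (log(eN/k))^{3/2}. -/

import Mathlib

open scoped ENNReal

instance : Fact ((1 : ℝ≥0∞) ≤ ∞) := ⟨le_top⟩

/-- The `k`-th Kolmogorov number of a continuous linear operator `T : X → Y`. -/
noncomputable def kolmogorovNumber {X Y : Type*} [NormedAddCommGroup X] [NormedSpace ℂ X]
    [NormedAddCommGroup Y] [NormedSpace ℂ Y] (T : X →L[ℂ] Y) (k : ℕ) : ℝ :=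
  sInf { r | ∃ L : Submodule ℂ Y, Module.rank ℂ L < (k : Cardinal) ∧
    r = ⨆ x : {x : X // ‖x‖ ≤ 1}, ⨅ z : L, ‖T x.1 - (z : Y)‖ }

/-- The identity operator `id : ℓ_{p₁}^N → ℓ_{p₂}^N` on `ℂ^N`. -/
noncomputable def lpId (p₁ p₂ : ℝ≥0∞) [Fact (1 ≤ p₁)] [Fact (1 ≤ p₂)] (N : ℕ) :
    PiLp p₁ (fun _ : Fin N => ℂ) →L[ℂ] PiLp p₂ (fun _ : Fin N => ℂ) :=
  LinearMap.toContinuousLinearMap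
    (((WithLp.linearEquiv p₂ ℂ (Fin N → ℂ)).symm.toLinearMap).comp
      (WithLp.linearEquiv p₁ ℂ (Fin N → ℂ)).toLinearMap)

open scoped BigOperators

/-- The sign `±1` encoded by a Boolean. -/
def boolSign (b : Bool) : ℝ := if b then 1 else -1

theorem expect_bool (f : Bool → ℝ) : 𝔼 b, f b = (f true + f false) / 2 := by
  rw [Fintype.expect_eq_sum_div_card]; simp

theorem expect_fin_succ {R : Type*} [Fintype R] {n : ℕ} (f : (Fin (n + 1) → R) → ℝ) :
    𝔼 G, f G = 𝔼 r, 𝔼 G : Fin n → R, f (Fin.cons r G) := by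
  rw [← Finset.expect_product' Finset.univ Finset.univ (fun r G => f (Fin.cons r G)),
    Finset.univ_product_univ]
  exact (Fintype.expect_equiv (Fin.consEquiv fun _ => R) _ _ fun _ => rfl).symm

theorem expect_prod_apply {R : Type*} [Fintype R] (f : R → ℝ) (m : ℕ) :
    𝔼 G : Fin m → R, ∏ i, f (G i) = (𝔼 r, f r) ^ m := by
  induction m with
  | zero => simp
  | succ m ih =>
    simp_rw [expect_fin_succ, Fin.prod_univ_succ, Fin.cons_zero, Fin.cons_succ,
      ← Finset.mul_expect, ih, ← Finset.expect_mul, pow_succ']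

theorem expect_rademacher_sq {n : ℕ} (y : Fin n → ℝ) :
    𝔼 r : Fin n → Bool, (∑ j, boolSign (r j) * y j) ^ 2 = ∑ j, y j ^ 2 := by
  induction n with
  | zero => simp
  | succ n ih =>
    rw [expect_fin_succ, Finset.expect_comm]
    simp_rw [Fin.sum_univ_succ, Fin.cons_zero, Fin.cons_succ, expect_bool]
    rw [← ih (fun j => y j.succ), ← Fintype.expect_const (ι := Fin n → Bool) (y 0 ^ 2),
      ← Finset.expect_add_distrib]
    refine Finset.expect_congr rfl fun r _ => ?_
    simp only [boolSign, if_true, Bool.false_eq_true, if_false]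
    ring

theorem expect_rademacher_pow_four_le {n : ℕ} (y : Fin n → ℝ) :
    𝔼 r : Fin n → Bool, (∑ j, boolSign (r j) * y j) ^ 4 ≤ 3 * (∑ j, y j ^ 2) ^ 2 := by
  induction n with
  | zero => simp
  | succ n ih =>
    have h2 := expect_rademacher_sq (fun j => y j.succ)
    have h4 := ih (fun j => y j.succ)
    rw [expect_fin_succ, Finset.expect_comm]
    simp_rw [Fin.sum_univ_succ, Fin.cons_zero, Fin.cons_succ, expect_bool]
    calc _ = 𝔼 r : Fin n → Bool, ((∑ j, boolSign (r j) * y j.succ) ^ 4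
          + 6 * y 0 ^ 2 * (∑ j, boolSign (r j) * y j.succ) ^ 2 + y 0 ^ 4) := by
          refine Finset.expect_congr rfl fun r _ => ?_
          simp only [boolSign, if_true, Bool.false_eq_true, if_false]
          ring
      _ ≤ _ := by
          rw [Finset.expect_add_distrib, Finset.expect_add_distrib, ← Finset.mul_expect, h2,
            Fintype.expect_const]
          nlinarith [sq_nonneg (y 0 ^ 2)]

theorem expect_exp_rademacher_le {n : ℕ} (y : Fin n → ℝ) :
    𝔼 r : Fin n → Bool, Real.exp (∑ j, boolSign (r j) * y j) ≤ Real.exp ((∑ j, y j ^ 2) / 2) := by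
  induction n with
  | zero => simp
  | succ n ih =>
    have h := ih (fun j => y j.succ)
    rw [expect_fin_succ]
    simp_rw [Fin.sum_univ_succ, Fin.cons_zero, Fin.cons_succ, Real.exp_add, ← Finset.mul_expect,
      ← Finset.expect_mul, add_div, Real.exp_add]
    refine mul_le_mul ?_ h (Finset.expect_nonneg fun _ _ => (Real.exp_pos _).le) (Real.exp_pos _).le
    rw [expect_bool]
    simpa [boolSign, Real.cosh_eq] using Real.cosh_le_exp_half_sq (y 0)

/-- A Khinchine inequality: the first moment of a normalised Rademacher sum is at least `1 / 2`. -/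
theorem half_le_expect_abs_rademacher {n : ℕ} (y : Fin n → ℝ) (hy : ∑ j, y j ^ 2 = 1) :
    1 / 2 ≤ 𝔼 r : Fin n → Bool, |∑ j, boolSign (r j) * y j| := by
  have key : ∀ x : ℝ, 3 / 4 * x ^ 2 - 1 / 16 * x ^ 4 ≤ |x| := fun x => by
    have h2 : x ^ 2 = |x| ^ 2 := (sq_abs x).symm
    have h4 : x ^ 4 = |x| ^ 4 := by rw [← abs_pow, abs_of_nonneg (by positivity)]
    rw [h2, h4]
    have h0 := abs_nonneg x
    nlinarith [mul_nonneg (mul_nonneg h0 (sq_nonneg (|x| - 2))) (by linarith : 0 ≤ |x| + 4)]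
  have h2 := expect_rademacher_sq y
  have h4 := expect_rademacher_pow_four_le y
  have := Finset.expect_le_expect (s := Finset.univ) fun (r : Fin n → Bool) _ =>
    key (∑ j, boolSign (r j) * y j)
  rw [Finset.expect_sub_distrib, ← Finset.mul_expect, ← Finset.mul_expect, h2, hy] at this
  rw [hy] at h4
  linarith

theorem expect_iSup_sub_abs_le {R ι : Type*} [Fintype R] [Finite ι] [Nonempty ι] [Nonempty R]
    (h : R → ι → ℝ) (e : R ≃ R) (he : ∀ r a, h (e r) a = -h r a) {c : ℝ}
    (hc : ∀ a, c ≤ 𝔼 r, |h r a|) (u : ι → ℝ) :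
    𝔼 r, ⨆ a, (u a + (c - |h r a|)) ≤ 𝔼 r, ⨆ a, (u a + 2 * h r a) := by
  have bdd : ∀ f : ι → ℝ, BddAbove (Set.range f) := fun f => Set.finite_range f |>.bddAbove
  have h1 : ∀ r, ⨆ a, (u a + (c - |h r a|)) ≤
      (𝔼 r', ⨆ a, (u a + 2 * |h r' a|)) / 2 + (⨆ a, (u a - 2 * |h r a|)) / 2 := fun r => by
    refine ciSup_le fun a => ?_
    have h2 : u a + 2 * 𝔼 r', |h r' a| ≤ 𝔼 r', ⨆ a, (u a + 2 * |h r' a|) := by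
      rw [Finset.mul_expect, ← Fintype.expect_const (ι := R) (u a), ← Finset.expect_add_distrib]
      refine Finset.expect_le_expect fun r' _ => ?_
      exact le_ciSup (f := fun a => u a + 2 * |h r' a|) (bdd _) a
    have h3 := le_ciSup (f := fun a => u a - 2 * |h r a|) (bdd _) a
    have := hc a
    linarith
  have h2 : ∀ r, (⨆ a, (u a + 2 * |h r a|)) + (⨆ a, (u a - 2 * |h r a|)) ≤
      (⨆ a, (u a + 2 * h r a)) + ⨆ a, (u a + 2 * h (e r) a) := fun r => by
    simp_rw [he]
    refine ciSup_add_ciSup_le fun a b => ?_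
    have ha := le_ciSup (f := fun a => u a + 2 * h r a) (bdd _)
    have hb := le_ciSup (f := fun a => u a + 2 * -h r a) (bdd _)
    have := ha a; have := ha b; have := hb a; have := hb b
    have := abs_sub_abs_le_abs_sub (h r a) (h r b)
    rcases abs_cases (h r a - h r b) with ⟨_, _⟩ | ⟨_, _⟩ <;> linarith
  have h3 := Finset.expect_le_expect (s := Finset.univ) fun r _ => h1 r
  have h4 := Finset.expect_le_expect (s := Finset.univ) fun r _ => h2 r
  rw [Finset.expect_add_distrib, Finset.expect_add_distrib,
    Fintype.expect_equiv e (fun r => ⨆ a, (u a + 2 * h (e r) a)) (fun r => ⨆ a, (u a + 2 * h r a))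
      fun _ => rfl] at h4
  rw [Finset.expect_add_distrib, Fintype.expect_const, ← Finset.expect_div] at h3
  linarith

/-- Symmetrisation and contraction for a finite family of symmetric random variables. -/
theorem expect_iSup_sum_sub_abs_le {R ι : Type*} [Fintype R] [Finite ι] [Nonempty ι] [Nonempty R]
    (h : R → ι → ℝ) (e : R ≃ R) (he : ∀ r a, h (e r) a = -h r a) {c : ℝ}
    (hc : ∀ a, c ≤ 𝔼 r, |h r a|) (m : ℕ) (u : ι → ℝ) :
    𝔼 G : Fin m → R, ⨆ a, (u a + ∑ i, (c - |h (G i) a|)) ≤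
      𝔼 G : Fin m → R, ⨆ a, (u a + ∑ i, 2 * h (G i) a) := by
  induction m generalizing u with
  | zero => simp
  | succ m ih =>
    calc _ = 𝔼 G : Fin m → R, 𝔼 r,
          ⨆ a, ((u a + ∑ i, (c - |h (G i) a|)) + (c - |h r a|)) := by
          rw [expect_fin_succ, Finset.expect_comm]
          simp_rw [Fin.sum_univ_succ, Fin.cons_zero, Fin.cons_succ, add_comm (c - _), ← add_assoc]
      _ ≤ 𝔼 G : Fin m → R, 𝔼 r, ⨆ a, ((u a + ∑ i, (c - |h (G i) a|)) + 2 * h r a) :=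
          Finset.expect_le_expect fun G _ => expect_iSup_sub_abs_le h e he hc _
      _ = 𝔼 r, 𝔼 G : Fin m → R, ⨆ a, ((u a + 2 * h r a) + ∑ i, (c - |h (G i) a|)) := by
          rw [Finset.expect_comm]
          simp_rw [add_right_comm]
      _ ≤ 𝔼 r, 𝔼 G : Fin m → R, ⨆ a, ((u a + 2 * h r a) + ∑ i, 2 * h (G i) a) :=
          Finset.expect_le_expect fun r _ => ih _
      _ = _ := by
          rw [expect_fin_succ]
          simp_rw [Fin.sum_univ_succ, Fin.cons_zero, Fin.cons_succ, add_assoc]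

theorem expect_exp_column_le {m N : ℕ} (j : Fin N) (θ : ℝ) :
    𝔼 G : Fin m → Fin N → Bool, Real.exp (θ * ∑ i, boolSign (G i j)) ≤
      Real.exp (m * θ ^ 2 / 2) := by
  have h := expect_exp_rademacher_le (Pi.single j θ)
  simp_rw [Finset.mul_sum, Real.exp_sum]
  rw [expect_prod_apply (fun r : Fin N → Bool => Real.exp (θ * boolSign (r j))), mul_div_assoc,
    Real.exp_nat_mul]
  refine pow_le_pow_left₀ (Finset.expect_nonneg fun _ _ => (Real.exp_pos _).le) ?_ m
  simpa [Pi.single_apply, mul_comm] using h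

theorem sq_max_le_exp {θ l v : ℝ} (hθ : 0 < θ) :
    (max (|v| - l) 0) ^ 2 ≤
      2 / θ ^ 2 * Real.exp (-(θ * l)) * (Real.exp (θ * v) + Real.exp (-θ * v)) := by
  have h1 : Real.exp (θ * |v|) ≤ Real.exp (θ * v) + Real.exp (-θ * v) := by
    rcases abs_cases v with ⟨h, _⟩ | ⟨h, _⟩ <;> rw [h]
    · linarith [Real.exp_pos (-θ * v)]
    · rw [mul_neg, ← neg_mul]; linarith [Real.exp_pos (θ * v)]
  refine le_trans ?_ (mul_le_mul_of_nonneg_left h1 (by positivity))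
  rw [mul_assoc, ← Real.exp_add, show -(θ * l) + θ * |v| = θ * (|v| - l) by ring]
  rcases le_total (|v| - l) 0 with h | h
  · rw [max_eq_right h, zero_pow two_ne_zero]; positivity
  · rw [max_eq_left h]
    have := Real.quadratic_le_exp_of_nonneg (mul_nonneg hθ.le h)
    have h2 : (θ * (|v| - l)) ^ 2 / 2 ≤ Real.exp (θ * (|v| - l)) := by
      nlinarith [mul_nonneg hθ.le h]
    rw [div_mul_eq_mul_div, le_div_iff₀ (by positivity)]
    nlinarith

/-- There is a sign matrix whose kernel has no unit vectors of small `ℓ₁` norm. -/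
theorem exists_sign_matrix {m N : ℕ} (hm : 1 ≤ m) {L : ℝ} (hL : 1 ≤ L)
    (hN : N * Real.exp (-L) ≤ m) :
    ∃ G : Fin m → Fin N → Bool, ∀ y : Fin N → ℝ, (∀ i, ∑ j, boolSign (G i j) * y j = 0) →
      ∑ j, y j ^ 2 = 1 → (m : ℝ) < 8 * √(10 * L * m) * ∑ j, |y j| := by
  by_contra! H
  choose y hker hy2 hy1 using H
  have hm0 : (1 : ℝ) ≤ m := by exact_mod_cast hm
  set l := √(10 * L * m) with hl
  have hl2 : l ^ 2 = 10 * L * m := Real.sq_sqrt (by positivity)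
  have hl0 : 0 < l := Real.sqrt_pos.2 (by positivity)
  set θ := l / m with hθ
  have hθ0 : 0 < θ := by positivity
  have bdd : ∀ f : (Fin m → Fin N → Bool) → ℝ, BddAbove (Set.range f) :=
    fun f => (Set.finite_range f).bddAbove
  set V : (Fin m → Fin N → Bool) → Fin N → ℝ := fun G j => ∑ i, boolSign (G i j) with hV
  set w : (Fin m → Fin N → Bool) → Fin N → ℝ := fun G j => max (|V G j| - l) 0 with hw
  have main := expect_iSup_sum_sub_abs_le
    (fun (r : Fin N → Bool) (a : Fin m → Fin N → Bool) => ∑ j, boolSign (r j) * y a j)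
    (Equiv.piCongrRight fun _ => Equiv.boolNot)
    (fun r a => by
      simp only [Equiv.piCongrRight_apply, Pi.map_apply, Equiv.boolNot_apply,
        ← Finset.sum_neg_distrib]
      refine Finset.sum_congr rfl fun j _ => ?_
      cases r j <;> simp [boolSign])
    (fun a => half_le_expect_abs_rademacher (y a) (hy2 a)) m 0
  simp only [Pi.zero_apply, zero_add] at main
  have lower : (m : ℝ) / 2 ≤ 𝔼 G : Fin m → Fin N → Bool,
      ⨆ a, ∑ i, (1 / 2 - |∑ j, boolSign (G i j) * y a j|) := by
    rw [← Fintype.expect_const (ι := Fin m → Fin N → Bool) ((m : ℝ) / 2)]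
    refine Finset.expect_le_expect fun G _ => ?_
    refine le_trans (le_of_eq ?_)
      (le_ciSup (f := fun a => ∑ i, (1 / 2 - |∑ j, boolSign (G i j) * y a j|)) (bdd _) G)
    simp [hker, div_eq_mul_inv]
  have upper : ∀ G : Fin m → Fin N → Bool, ⨆ a, ∑ i, 2 * ∑ j, boolSign (G i j) * y a j ≤
      m / 4 + m / 8 + 8 / m * ∑ j, w G j ^ 2 := fun G => by
    refine ciSup_le fun a => ?_
    have e1 : ∑ i, 2 * ∑ j, boolSign (G i j) * y a j = ∑ j, 2 * (V G j * y a j) := by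
      simp only [hV, Finset.sum_mul, Finset.mul_sum]
      exact Finset.sum_comm
    have e2 : ∀ j, 2 * (V G j * y a j) ≤
        2 * l * |y a j| + m / 8 * y a j ^ 2 + 8 / m * w G j ^ 2 := fun j => by
      have h1 : V G j * y a j ≤ (l + w G j) * |y a j| := by
        calc _ ≤ |V G j| * |y a j| := by rw [← abs_mul]; exact le_abs_self _
          _ ≤ _ := by
            gcongr
            have := le_max_left (|V G j| - l) 0
            simp only [hw]; linarith
      have h2 : 2 * (w G j * |y a j|) ≤ m / 8 * y a j ^ 2 + 8 / m * w G j ^ 2 := by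
        have e : m / 8 * y a j ^ 2 + 8 / m * w G j ^ 2 - 2 * (w G j * |y a j|)
            = m / 8 * (|y a j| - 8 / m * w G j) ^ 2 := by
          rw [← sq_abs (y a j)]; field_simp; ring
        have : 0 ≤ m / 8 * (|y a j| - 8 / m * w G j) ^ 2 := by positivity
        linarith
      linarith
    rw [e1]
    refine (Finset.sum_le_sum fun j _ => e2 j).trans ?_
    rw [Finset.sum_add_distrib, Finset.sum_add_distrib, ← Finset.mul_sum, ← Finset.mul_sum,
      ← Finset.mul_sum, hy2]
    linarith [hy1 a]
  have tail : ∀ j, 𝔼 G, w G j ^ 2 ≤ 4 / θ ^ 2 * Real.exp (-(5 * L)) := fun j => by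
    refine (Finset.expect_le_expect fun G _ =>
      sq_max_le_exp (θ := θ) (l := l) (v := V G j) hθ0).trans ?_
    rw [← Finset.mul_expect, Finset.expect_add_distrib]
    have h1 := expect_exp_column_le (m := m) j θ
    have h2 := expect_exp_column_le (m := m) j (-θ)
    rw [neg_sq] at h2
    have e1 : m * θ ^ 2 / 2 = 5 * L := by
      rw [hθ, div_pow, hl2]; field_simp; ring
    have e2 : θ * l = 10 * L := by
      rw [hθ, div_mul_eq_mul_div, ← sq, hl2]; field_simp
    rw [e1] at h1 h2
    rw [e2]
    calc _ ≤ 2 / θ ^ 2 * Real.exp (-(10 * L)) * (Real.exp (5 * L) + Real.exp (5 * L)) := by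
          gcongr
      _ = 4 / θ ^ 2 * (Real.exp (-(10 * L)) * Real.exp (5 * L)) := by ring
      _ = _ := by rw [← Real.exp_add]; ring_nf
  have total : 𝔼 G, ∑ j, w G j ^ 2 ≤ m ^ 2 / 80 := by
    have h5 : Real.exp (-(5 * L)) ≤ Real.exp (-L) * (1 / 32) := by
      have h4 : Real.exp (-(4 : ℝ)) ≤ 1 / 32 := by
        rw [Real.exp_neg, inv_eq_one_div]
        have h := Real.exp_one_gt_d9
        have : Real.exp 4 = Real.exp 1 ^ 4 := by rw [← Real.exp_nat_mul]; norm_num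
        have h' : (2.5 : ℝ) ^ 4 ≤ Real.exp 1 ^ 4 := by gcongr; linarith
        exact one_div_le_one_div_of_le (by norm_num) (by rw [this]; linarith)
      calc _ ≤ Real.exp (-L + -4) := Real.exp_le_exp.2 (by linarith)
        _ = Real.exp (-L) * Real.exp (-4) := Real.exp_add _ _
        _ ≤ _ := by gcongr
    rw [Finset.expect_sum_comm]
    have e : 4 / θ ^ 2 = 4 * m / (10 * L) := by
      rw [hθ, div_pow, hl2]; field_simp
    calc _ ≤ ∑ _j : Fin N, 4 * m / (10 * L) * (Real.exp (-L) * (1 / 32)) := by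
          refine Finset.sum_le_sum fun j _ => (tail j).trans ?_
          rw [e]; gcongr
      _ = 4 * m / (10 * L) * (1 / 32) * (N * Real.exp (-L)) := by
          rw [Finset.sum_const, Finset.card_univ, Fintype.card_fin, nsmul_eq_mul]; ring
      _ ≤ 4 * m / (10 * 1) * (1 / 32) * m := by gcongr
      _ ≤ _ := by nlinarith
  have fin := lower.trans (main.trans (Finset.expect_le_expect fun G _ => upper G))
  rw [Finset.expect_add_distrib, Fintype.expect_const, ← Finset.mul_expect] at fin
  have : 8 / (m : ℝ) * 𝔼 G, ∑ j, w G j ^ 2 ≤ 8 / m * (m ^ 2 / 80) := by gcongr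
  have e : 8 / (m : ℝ) * (m ^ 2 / 80) = m / 10 := by field_simp; norm_num
  linarith

/-- If the kernel of `A` has no vectors with small `ℓ₁` norm, then the rows of `A` span a subspace
close to the Euclidean unit ball in the `ℓ_∞` norm. -/
theorem exists_row_combination {m N : ℕ} (A : Fin m → Fin N → ℝ) {ε : ℝ} (hε : 0 ≤ ε)
    (hA : ∀ y : Fin N → ℝ, (∀ i, ∑ j, A i j * y j = 0) → ∑ j, y j ^ 2 = 1 → 1 ≤ ε * ∑ j, |y j|)
    (x : Fin N → ℝ) (hx : ∑ j, x j ^ 2 ≤ 1) :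
    ∃ c : Fin m → ℝ, ∀ j, |x j - ∑ i, c i * A i j| ≤ ε := by
  let φ : (Fin N → ℝ) → (Fin N → ℝ) →ₗ[ℝ] ℝ := fun a => ∑ j, a j • LinearMap.proj j
  have hφ : ∀ a y, φ a y = ∑ j, a j * y j := fun a y => by simp [φ]
  let K : Submodule ℝ (Fin N → ℝ) := ⨅ i, LinearMap.ker (φ (A i))
  have hK : ∀ y, y ∈ K ↔ ∀ i, ∑ j, A i j * y j = 0 := fun y => by
    simp [K, Submodule.mem_iInf, LinearMap.mem_ker, hφ]
  have hdom : ∀ y ∈ K, φ x y ≤ ε * ∑ j, |y j| := fun y hy => by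
    rw [hφ]
    have hcs := Real.sum_mul_le_sqrt_mul_sqrt Finset.univ x y
    set s := √(∑ j, y j ^ 2) with hs
    have hs0 : 0 ≤ s := Real.sqrt_nonneg _
    have hss : s ^ 2 = ∑ j, y j ^ 2 := Real.sq_sqrt (Finset.sum_nonneg fun _ _ => sq_nonneg _)
    have h1 : ∑ j, x j * y j ≤ s := hcs.trans <|
      mul_le_of_le_one_left hs0 (Real.sqrt_le_one.2 hx)
    refine h1.trans ?_
    rcases hs0.eq_or_lt with h0 | h0
    · rw [← h0]
      exact mul_nonneg hε (Finset.sum_nonneg fun _ _ => abs_nonneg _)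
    · have := hA (s⁻¹ • y) ((hK _).1 (K.smul_mem _ hy)) (by
        simp_rw [Pi.smul_apply, smul_eq_mul, mul_pow, ← Finset.mul_sum, ← hss]
        field_simp)
      simp_rw [Pi.smul_apply, smul_eq_mul, abs_mul, ← Finset.mul_sum, abs_of_pos (inv_pos.2 h0)]
        at this
      rw [mul_left_comm, inv_mul_eq_div, one_le_div h0] at this
      exact this
  obtain ⟨g, hg, hgle⟩ := exists_extension_of_le_sublinear ⟨K, (φ x).domRestrict K⟩
    (fun y => ε * ∑ j, |y j|)
    (fun c hc y => by
      simp_rw [Pi.smul_apply, smul_eq_mul, abs_mul, ← Finset.mul_sum, abs_of_pos hc]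
      ring)
    (fun y z => by
      rw [← mul_add, ← Finset.sum_add_distrib]
      exact mul_le_mul_of_nonneg_left (Finset.sum_le_sum fun j _ => abs_add_le _ _) hε)
    (fun y => hdom y y.2)
  have hspan : φ x - g ∈ Submodule.span ℝ (Set.range fun i => φ (A i)) := by
    refine mem_span_of_iInf_ker_le_ker fun y hy => ?_
    rw [LinearMap.mem_ker, LinearMap.sub_apply, sub_eq_zero]
    exact (hg ⟨y, hy⟩).symm
  obtain ⟨c, hc⟩ := (Submodule.mem_span_range_iff_exists_fun ℝ).1 hspan
  refine ⟨c, fun j => ?_⟩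
  have h1 := LinearMap.congr_fun hc (Pi.single j 1)
  simp only [LinearMap.sum_apply, LinearMap.smul_apply, LinearMap.sub_apply, hφ, smul_eq_mul,
    Pi.single_apply, mul_ite, mul_one, mul_zero, Finset.sum_ite_eq', Finset.mem_univ,
    if_true] at h1
  have h2 := hgle (Pi.single j 1)
  have h3 := hgle (Pi.single j (-1))
  rw [Pi.single_neg, map_neg] at h3
  simp only [Pi.neg_apply, abs_neg] at h3
  have h4 : ∑ l, |(Pi.single j 1 : Fin N → ℝ) l| = 1 := by
    simp [Pi.single_apply, apply_ite abs]
  rw [h4, mul_one] at h2 h3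
  rw [h1, abs_le]
  constructor <;> linarith

/-- Some standard basis vector is far from a subspace of small dimension. -/
theorem exists_single_far {M : ℕ} (hM : 0 < M) (S : Submodule ℂ (EuclideanSpace ℂ (Fin M)))
    (hS : 4 * Module.finrank ℂ S ≤ M) :
    ∃ i, ∀ z ∈ S, 3 / 4 ≤ ‖EuclideanSpace.single i (1 : ℂ) - z‖ ^ 2 := by
  have tr : (∑ i, ‖Sᗮ.starProjection (EuclideanSpace.single i (1 : ℂ))‖ ^ 2 : ℝ) =
      Module.finrank ℂ Sᗮ := by
    have h1 := LinearMap.trace_eq_sum_inner (Sᗮ.starProjection : _ →ₗ[ℂ] _)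
      (EuclideanSpace.basisFun (Fin M) ℂ)
    have h2 : LinearMap.IsProj Sᗮ (Sᗮ.starProjection : EuclideanSpace ℂ (Fin M) →ₗ[ℂ] _) :=
      ⟨fun x => Sᗮ.starProjection_apply_mem x, fun x hx => Submodule.starProjection_eq_self_iff.2 hx⟩
    rw [h2.trace] at h1
    have h3 := congrArg Complex.re h1
    simp only [Complex.natCast_re, Complex.re_sum, EuclideanSpace.basisFun_apply] at h3
    rw [h3]
    refine Finset.sum_congr rfl fun i _ => ?_
    have h4 := Sᗮ.re_inner_starProjection_eq_normSq (EuclideanSpace.single i (1 : ℂ))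
    rw [Submodule.inner_starProjection_left_eq_right] at h4
    exact h4.symm
  have dim : Module.finrank ℂ S + Module.finrank ℂ Sᗮ = M := by
    simpa using S.finrank_add_finrank_orthogonal
  obtain ⟨i, -, hi⟩ : ∃ i ∈ Finset.univ, (3 / 4 : ℝ) ≤
      ‖Sᗮ.starProjection (EuclideanSpace.single i (1 : ℂ))‖ ^ 2 := by
    have : Nonempty (Fin M) := ⟨⟨0, hM⟩⟩
    refine Finset.exists_le_of_sum_le Finset.univ_nonempty ?_
    rw [tr, Finset.sum_const, Finset.card_univ, Fintype.card_fin, nsmul_eq_mul]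
    have h1 : (Module.finrank ℂ S : ℝ) + Module.finrank ℂ Sᗮ = M := by exact_mod_cast dim
    have h2 : 4 * (Module.finrank ℂ S : ℝ) ≤ M := by exact_mod_cast hS
    linarith
  refine ⟨i, fun z hz => hi.trans ?_⟩
  have hz0 : Sᗮ.starProjection z = 0 := by
    rw [Submodule.starProjection_apply_eq_zero_iff]
    exact S.le_orthogonal_orthogonal hz
  have := Sᗮ.norm_starProjection_apply_le (EuclideanSpace.single i (1 : ℂ) - z)
  rw [map_sub, hz0, sub_zero] at this
  gcongr

theorem sum_norm_sq_le_one {p : ℝ≥0∞} [Fact (1 ≤ p)] (hp : p < 2) {N : ℕ}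
    (x : PiLp p fun _ : Fin N => ℂ) (hx : ‖x‖ ≤ 1) : ∑ j, ‖x j‖ ^ 2 ≤ 1 := by
  have hp1 : (1 : ℝ) ≤ p.toReal := by
    rw [← ENNReal.toReal_one]
    exact ENNReal.toReal_mono (hp.trans ENNReal.ofNat_lt_top).ne Fact.out
  have hp2 : p.toReal ≤ 2 := by
    simpa using ENNReal.toReal_mono (by simp) hp.le
  have hp0 : 0 < p.toReal := by linarith
  rw [PiLp.norm_eq_sum hp0] at hx
  have hs : 0 ≤ ∑ j, ‖x j‖ ^ p.toReal := Finset.sum_nonneg fun _ _ => by positivity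
  have h1 : ∑ j, ‖x j‖ ^ p.toReal ≤ 1 := by
    by_contra! h
    exact absurd hx (not_le.2 (Real.one_lt_rpow h (by positivity)))
  refine (Finset.sum_le_sum fun j _ => ?_).trans h1
  have hj : ‖x j‖ ^ p.toReal ≤ 1 :=
    (Finset.single_le_sum (f := fun j => ‖x j‖ ^ p.toReal) (fun _ _ => by positivity)
      (Finset.mem_univ j)).trans h1
  have hj1 : ‖x j‖ ≤ 1 := by
    by_contra! h
    exact absurd hj (not_le.2 (Real.one_lt_rpow h hp0))
  rw [← Real.rpow_two]
  exact Real.rpow_le_rpow_of_exponent_ge_of_imp (norm_nonneg _) hj1 hp2 fun _ h => by linarith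

theorem kolmogorovNumber_le {X Y : Type*} [NormedAddCommGroup X] [NormedSpace ℂ X]
    [NormedAddCommGroup Y] [NormedSpace ℂ Y] {T : X →L[ℂ] Y} {k : ℕ} {C : ℝ} (L : Submodule ℂ Y)
    (hL : Module.rank ℂ L < k) (h : ∀ x, ‖x‖ ≤ 1 → ∃ z ∈ L, ‖T x - z‖ ≤ C) :
    kolmogorovNumber T k ≤ C := by
  refine le_trans (csInf_le ⟨0, ?_⟩ ⟨L, hL, rfl⟩) ?_
  · rintro _ ⟨L, -, rfl⟩
    exact Real.iSup_nonneg fun _ => Real.iInf_nonneg fun _ => norm_nonneg _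
  · have : Nonempty {x : X // ‖x‖ ≤ 1} := ⟨⟨0, by simp⟩⟩
    refine ciSup_le fun x => ?_
    obtain ⟨z, hz, hle⟩ := h x.1 x.2
    refine (ciInf_le ⟨0, ?_⟩ (⟨z, hz⟩ : L)).trans hle
    rintro _ ⟨_, rfl⟩
    exact norm_nonneg _

theorem le_kolmogorovNumber {X Y : Type*} [NormedAddCommGroup X] [NormedSpace ℂ X]
    [NormedAddCommGroup Y] [NormedSpace ℂ Y] {T : X →L[ℂ] Y} {k : ℕ} (hk : 1 ≤ k) {C : ℝ}
    (h : ∀ L : Submodule ℂ Y, Module.rank ℂ L < k → ∃ x, ‖x‖ ≤ 1 ∧ ∀ z ∈ L, C ≤ ‖T x - z‖) :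
    C ≤ kolmogorovNumber T k := by
  refine le_csInf ⟨_, ⊥, by simpa using Nat.lt_of_lt_of_le one_pos hk, rfl⟩ ?_
  rintro _ ⟨L, hL, rfl⟩
  obtain ⟨x, hx, hxz⟩ := h L hL
  refine le_trans (le_ciInf fun z : L => hxz z z.2) (le_ciSup (f := fun x : {x : X // ‖x‖ ≤ 1} =>
    ⨅ z : L, ‖T x.1 - (z : Y)‖) ⟨‖T‖, ?_⟩ ⟨x, hx⟩)
  rintro _ ⟨y, rfl⟩
  refine (ciInf_le ⟨0, ?_⟩ (0 : L)).trans ?_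
  · rintro _ ⟨_, rfl⟩
    exact norm_nonneg _
  · simpa using T.unit_le_opNorm y.1 y.2

theorem norm_le_of_forall_apply_le {N : ℕ} (x : PiLp ∞ fun _ : Fin N => ℂ) {C : ℝ} (hC : 0 ≤ C)
    (h : ∀ j, ‖x j‖ ≤ C) : ‖x‖ ≤ C := by
  rw [PiLp.norm_eq_ciSup]
  exact Real.iSup_le h hC

theorem lower_bound_kolmogorovNumber (p : ℝ≥0∞) [Fact (1 ≤ p)] {N k : ℕ} (hk : 1 ≤ k)
    (hN : 4 * k ≤ N) : 1 / 4 * (√k)⁻¹ ≤ kolmogorovNumber (lpId p ∞ N) k := by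
  refine le_kolmogorovNumber hk fun L hL => ?_
  let f : PiLp ∞ (fun _ : Fin N => ℂ) →ₗ[ℂ] EuclideanSpace ℂ (Fin (4 * k)) :=
    { toFun := fun x => WithLp.toLp 2 fun i => x (Fin.castLE hN i)
      map_add' := fun _ _ => rfl
      map_smul' := fun _ _ => rfl }
  have hS : Module.finrank ℂ (L.map f) < k := by
    refine (Submodule.finrank_map_le f L).trans_lt ?_
    rw [← Module.finrank_eq_rank] at hL
    exact_mod_cast hL
  obtain ⟨i, hi⟩ := exists_single_far (by omega) (L.map f) (by omega)
  refine ⟨PiLp.single p (Fin.castLE hN i) 1, by simp, fun z hz => ?_⟩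
  set v := lpId p ∞ N (PiLp.single p (Fin.castLE hN i) 1) - z with hv
  have e : EuclideanSpace.single i (1 : ℂ) - f z = f v := by
    rw [hv, map_sub]
    congr 1
    ext j
    change (Pi.single i 1 : Fin (4 * k) → ℂ) j =
      (Pi.single (Fin.castLE hN i) 1 : Fin N → ℂ) (Fin.castLE hN j)
    simp [Pi.single_apply]
  have h1 := hi (f z) (Submodule.mem_map_of_mem hz)
  rw [e, EuclideanSpace.norm_sq_eq] at h1
  have h2 : ∑ j, ‖f v j‖ ^ 2 ≤ ∑ _j : Fin (4 * k), ‖v‖ ^ 2 :=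
    Finset.sum_le_sum fun j _ => by
      gcongr
      exact PiLp.norm_apply_le v _
  rw [Finset.sum_const, Finset.card_univ, Fintype.card_fin, nsmul_eq_mul] at h2
  push_cast at h2
  have hk0 : (0 : ℝ) < k := by exact_mod_cast hk
  refine le_of_sq_le_sq ?_ (norm_nonneg _)
  rw [mul_pow, inv_pow, Real.sq_sqrt hk0.le, ← div_eq_mul_inv, div_le_iff₀ hk0]
  linarith

theorem exists_submodule_near {N m : ℕ} (A : Fin m → Fin N → ℝ) {ε : ℝ} (hε : 0 ≤ ε)
    (hA : ∀ y : Fin N → ℝ, (∀ i, ∑ j, A i j * y j = 0) → ∑ j, y j ^ 2 = 1 → 1 ≤ ε * ∑ j, |y j|) :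
    ∃ L : Submodule ℂ (PiLp ∞ fun _ : Fin N => ℂ), Module.rank ℂ L ≤ m ∧
      ∀ x : Fin N → ℂ, ∑ j, ‖x j‖ ^ 2 ≤ 1 → ∃ z ∈ L, ‖WithLp.toLp ∞ x - z‖ ≤ 2 * ε := by
  let r : Fin m → PiLp ∞ (fun _ : Fin N => ℂ) := fun i => WithLp.toLp ∞ fun j => (A i j : ℂ)
  refine ⟨Submodule.span ℂ (Set.range r), ?_, fun x hx => ?_⟩
  · rw [← Module.finrank_eq_rank]
    exact_mod_cast (finrank_range_le_card r).trans_eq (Fintype.card_fin m)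
  · have hre : ∑ j, (x j).re ^ 2 ≤ 1 := (Finset.sum_le_sum fun j _ => by
      rw [← sq_abs]; gcongr; exact Complex.abs_re_le_norm _).trans hx
    have him : ∑ j, (x j).im ^ 2 ≤ 1 := (Finset.sum_le_sum fun j _ => by
      rw [← sq_abs]; gcongr; exact Complex.abs_im_le_norm _).trans hx
    obtain ⟨c, hc⟩ := exists_row_combination A hε hA _ hre
    obtain ⟨d, hd⟩ := exists_row_combination A hε hA _ him
    refine ⟨∑ i, (⟨c i, d i⟩ : ℂ) • r i, Submodule.sum_mem _ fun i _ => Submodule.smul_mem _ _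
      (Submodule.subset_span ⟨i, rfl⟩), norm_le_of_forall_apply_le _ (by positivity) fun j => ?_⟩
    refine (Complex.norm_le_abs_re_add_abs_im _).trans ?_
    have h1 := hc j
    have h2 := hd j
    simp only [r, PiLp.sub_apply, WithLp.ofLp_sum, Finset.sum_apply, PiLp.smul_apply, smul_eq_mul,
      Complex.sub_re, Complex.sub_im, Complex.re_sum, Complex.im_sum, Complex.re_mul_ofReal,
      Complex.im_mul_ofReal]
    linarith

theorem upper_bound_kolmogorovNumber (p : ℝ≥0∞) [Fact (1 ≤ p)] (hp : p < 2) {N k : ℕ}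
    (hk : 1 ≤ k) {L : ℝ} (hL : 1 ≤ L) (hN : 2 * (N * Real.exp (-L)) ≤ k) :
    kolmogorovNumber (lpId p ∞ N) k ≤ 80 * (√k)⁻¹ * √L := by
  have hL1 : 1 ≤ √L := Real.one_le_sqrt.2 hL
  rcases hk.eq_or_lt with rfl | hk
  · refine kolmogorovNumber_le ⊥ (by simp) fun x hx => ⟨0, zero_mem _, ?_⟩
    have hx2 := sum_norm_sq_le_one hp x hx
    refine (norm_le_of_forall_apply_le _ zero_le_one fun j => ?_).trans
      (show (1 : ℝ) ≤ _ by norm_num; linarith)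
    rw [sub_zero]
    have : ‖x j‖ ^ 2 ≤ 1 := (Finset.single_le_sum (f := fun j => ‖x j‖ ^ 2)
      (fun _ _ => by positivity) (Finset.mem_univ j)).trans hx2
    exact (sq_le_one_iff₀ (norm_nonneg _)).1 this
  · obtain ⟨m, rfl⟩ : ∃ m, k = m + 1 := ⟨k - 1, by omega⟩
    have hm : 1 ≤ m := by omega
    have hm0 : (1 : ℝ) ≤ m := by exact_mod_cast hm
    push_cast at hN
    obtain ⟨G, hG⟩ := exists_sign_matrix (N := N) hm hL (by linarith)
    set ε := 8 * √(10 * L * m) / m with hε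
    obtain ⟨S, hS, hSx⟩ := exists_submodule_near (fun i j => boolSign (G i j)) (ε := ε)
      (by positivity) fun y hy hy2 => by
        rw [hε, div_mul_eq_mul_div, one_le_div (by linarith)]
        exact (hG y hy hy2).le
    refine kolmogorovNumber_le S (hS.trans_lt (by exact_mod_cast Nat.lt_succ_self m)) fun x hx => ?_
    obtain ⟨z, hz, hle⟩ := hSx x (sum_norm_sq_le_one hp x hx)
    refine ⟨z, hz, hle.trans ?_⟩
    refine le_of_sq_le_sq ?_ (by positivity)
    rw [hε, mul_pow, div_pow, mul_pow, mul_pow, mul_pow, inv_pow, Real.sq_sqrt (by positivity),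
      Real.sq_sqrt (by positivity), Real.sq_sqrt (by positivity)]
    push_cast
    have e1 : 2 ^ 2 * (8 ^ 2 * (10 * L * m) / (m : ℝ) ^ 2) = 2560 * L / m := by
      field_simp; norm_num
    rw [e1, mul_right_comm, ← div_eq_mul_inv, div_le_div_iff₀ (by positivity) (by positivity)]
    nlinarith

/-- If `1 ≤ p < 2`, then for `4k ≤ N`:
`c₁ k^{-1/2} ≤ d_k(id : ℓ_p^N → ℓ_∞^N) ≤ c₂ k^{-1/2} (log(eN/k))^{3/2}`. -/
theorem stmt8 (p : ℝ≥0∞) [Fact (1 ≤ p)] (hp : p < 2) :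
    ∃ c₁ c₂ : ℝ, 0 < c₁ ∧ 0 < c₂ ∧
      ∀ N k : ℕ, 1 ≤ k → 4 * k ≤ N →
        c₁ * (k : ℝ) ^ (-(1/2) : ℝ) ≤ kolmogorovNumber (lpId p ∞ N) k ∧
        kolmogorovNumber (lpId p ∞ N) k
          ≤ c₂ * (k : ℝ) ^ (-(1/2) : ℝ)
            * (Real.log (Real.exp 1 * (N : ℝ) / (k : ℝ))) ^ ((3 : ℝ)/2) := by
  refine ⟨1 / 4, 80, by norm_num, by norm_num, fun N k hk hN => ?_⟩
  have hk0 : (0 : ℝ) < k := by exact_mod_cast hk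
  have hN0 : 4 * (k : ℝ) ≤ N := by exact_mod_cast hN
  have e : (k : ℝ) ^ (-(1 / 2) : ℝ) = (√k)⁻¹ := by
    rw [Real.rpow_neg hk0.le, Real.sqrt_eq_rpow]
  rw [e]
  refine ⟨lower_bound_kolmogorovNumber p hk hN, ?_⟩
  have harg : 0 < Real.exp 1 * (N : ℝ) / k := by
    have : (0 : ℝ) < N := by linarith
    positivity
  set L := Real.log (Real.exp 1 * (N : ℝ) / k) with hLdef
  have hL : 1 ≤ L := by
    rw [hLdef, Real.le_log_iff_exp_le harg, le_div_iff₀ hk0]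
    gcongr
    linarith
  refine (upper_bound_kolmogorovNumber p hp hk hL ?_).trans ?_
  · rw [Real.exp_neg, hLdef, Real.exp_log harg]
    have h2 : 2 ≤ Real.exp 1 := by linarith [Real.exp_one_gt_d9]
    have hN1 : (0 : ℝ) < N := by linarith
    have e2 : 2 * ((N : ℝ) * (Real.exp 1 * N / k)⁻¹) = 2 * k / Real.exp 1 := by
      field_simp
    rw [e2, div_le_iff₀ (Real.exp_pos 1)]
    nlinarith
  · rw [Real.sqrt_eq_rpow L]
    exact mul_le_mul_of_nonneg_left (Real.rpow_le_rpow_of_exponent_le hL (by norm_num))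
      (by positivity)
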